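/- arXiv:1709.07064 — 7 statements merged into one kernel-verified Lean document; each statement's English description precedes it below -/
import Mathlib

section
/- In the overlapping group lasso setup with λ > 0, a replicated coefficient vector β̂^Z with induced vector β̂ ∈ ℝ^p is a minimizer of Q if and only if: for every group k with β̂_{J_k} ≠ 0 and every j ∈ J_k, −(1/n)ψ_jᵀ(y − φβ̂) + λ√d_k · β̂_{jk}/‖β̂_{J_k}‖₂ = 0; and for every group k with β̂_{J_k} = 0, the vector ((1/n)ψ_jᵀ(y − φβ̂))_{j∈J_k} has Euclidean norm at most λ√d_k. -/
open Finset in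
/-- Convexity of the Euclidean norm of a vector restricted to a finite set of coordinates. -/
theorem sqrt_sum_sq_segment_le {ι : Type*} (s : Finset ι) (u v : ι → ℝ) {t : ℝ}
    (ht0 : 0 ≤ t) (ht1 : t ≤ 1) :
    √(∑ k ∈ s, (u k + t * (v k - u k)) ^ 2)
      ≤ √(∑ k ∈ s, u k ^ 2) + t * (√(∑ k ∈ s, v k ^ 2) - √(∑ k ∈ s, u k ^ 2)) := by
  have hu := Real.sq_sqrt (sum_nonneg fun k (_ : k ∈ s) => sq_nonneg (u k))
  have hv := Real.sq_sqrt (sum_nonneg fun k (_ : k ∈ s) => sq_nonneg (v k))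
  have hcs := Real.sum_mul_le_sqrt_mul_sqrt s u v
  have hu0 := Real.sqrt_nonneg (∑ k ∈ s, u k ^ 2)
  have hv0 := Real.sqrt_nonneg (∑ k ∈ s, v k ^ 2)
  have hexp : ∑ k ∈ s, (u k + t * (v k - u k)) ^ 2 = (1 - t) ^ 2 * ∑ k ∈ s, u k ^ 2
      + 2 * (t * (1 - t)) * ∑ k ∈ s, u k * v k + t ^ 2 * ∑ k ∈ s, v k ^ 2 := by
    simp only [mul_sum, ← sum_add_distrib]
    exact sum_congr rfl fun k _ => by ring
  apply Real.sqrt_le_iff.2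
  constructor
  · nlinarith [mul_nonneg ht0 hv0, mul_nonneg (sub_nonneg.2 ht1) hu0]
  · rw [hexp]
    nlinarith [mul_le_mul_of_nonneg_left hcs (mul_nonneg ht0 (sub_nonneg.2 ht1))]

open Finset in
/-- Characterization of the subgradients `r` at `u` of `w` times the Euclidean norm on the
coordinates in `s`. -/
theorem subgradient_sqrt_sum_sq_iff {ι : Type*} (s : Finset ι) (u r : ι → ℝ) {w : ℝ}
    (hw : 0 ≤ w) :
    (∀ v : ι → ℝ, ∑ k ∈ s, r k * (v k - u k)
        ≤ w * (√(∑ k ∈ s, v k ^ 2) - √(∑ k ∈ s, u k ^ 2)))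
      ↔ ((∃ k ∈ s, u k ≠ 0) → ∀ k ∈ s, -r k + w * u k / √(∑ l ∈ s, u l ^ 2) = 0)
        ∧ ((∀ k ∈ s, u k = 0) → √(∑ k ∈ s, r k ^ 2) ≤ w) := by
  have hu := Real.sq_sqrt (sum_nonneg fun k (_ : k ∈ s) => sq_nonneg (u k))
  have hr := Real.sq_sqrt (sum_nonneg fun k (_ : k ∈ s) => sq_nonneg (r k))
  have hr0 := Real.sqrt_nonneg (∑ k ∈ s, r k ^ 2)
  have hpos : (∃ k ∈ s, u k ≠ 0) → 0 < √(∑ k ∈ s, u k ^ 2) := by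
    rintro ⟨k, hk, hne⟩
    exact Real.sqrt_pos.2 (sum_pos' (fun k _ => sq_nonneg _) ⟨k, hk, by positivity⟩)
  have hsplit (v : ι → ℝ) : ∑ k ∈ s, r k * (v k - u k)
      = ∑ k ∈ s, r k * v k - ∑ k ∈ s, r k * u k := by
    simp only [mul_sub, sum_sub_distrib]
  constructor
  · intro h
    have hinner : w * √(∑ k ∈ s, u k ^ 2) ≤ ∑ k ∈ s, r k * u k := by
      have := h 0
      rw [hsplit] at this
      simpa using this
    have hinner' : ∑ k ∈ s, r k * u k ≤ w * √(∑ k ∈ s, u k ^ 2) := by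
      have h2 := h fun k => 2 * u k
      have e : √(∑ k ∈ s, (2 * u k) ^ 2) = 2 * √(∑ k ∈ s, u k ^ 2) := by
        simp only [mul_pow, ← mul_sum]
        rw [Real.sqrt_mul (by positivity), Real.sqrt_sq (by norm_num)]
      rw [e] at h2
      have e2 : ∑ k ∈ s, r k * (2 * u k - u k) = ∑ k ∈ s, r k * u k :=
        sum_congr rfl fun k _ => by ring
      linarith
    have hle : √(∑ k ∈ s, r k ^ 2) ≤ w := by
      have h3 := h r
      rw [hsplit] at h3
      have e : ∑ k ∈ s, r k * r k = ∑ k ∈ s, r k ^ 2 := sum_congr rfl fun k _ => by ring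
      by_contra! hlt
      nlinarith
    refine ⟨fun hne k hk => ?_, fun _ => hle⟩
    have hp := hpos hne
    set N := √(∑ k ∈ s, u k ^ 2)
    have hsum : ∑ k ∈ s, (-r k + w * u k / N) ^ 2 = ∑ k ∈ s, r k ^ 2
        - 2 * (w / N) * ∑ k ∈ s, r k * u k + (w / N) ^ 2 * ∑ k ∈ s, u k ^ 2 := by
      simp only [mul_sum, ← sum_add_distrib, ← sum_sub_distrib]
      exact sum_congr rfl fun k _ => by ring
    have hval : ∑ k ∈ s, (-r k + w * u k / N) ^ 2 = ∑ k ∈ s, r k ^ 2 - w ^ 2 := by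
      rw [hsum, ← hu, show ∑ k ∈ s, r k * u k = w * N by linarith]
      field_simp
      ring
    have hnn := sum_nonneg fun k (_ : k ∈ s) => sq_nonneg (-r k + w * u k / N)
    have := (sum_eq_zero_iff_of_nonneg fun k _ => sq_nonneg (-r k + w * u k / N)).1
      (by nlinarith) k hk
    exact (pow_eq_zero_iff two_ne_zero).1 this
  · rintro ⟨h1, h2⟩ v
    have hv0 := Real.sqrt_nonneg (∑ k ∈ s, v k ^ 2)
    rw [hsplit]
    by_cases hne : ∃ k ∈ s, u k ≠ 0
    · have hp := hpos hne
      have hcs := Real.sum_mul_le_sqrt_mul_sqrt s u v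
      have h1 := h1 hne
      set N := √(∑ k ∈ s, u k ^ 2)
      have hinner (x : ι → ℝ) : ∑ k ∈ s, r k * x k = w / N * ∑ k ∈ s, u k * x k := by
        rw [mul_sum]
        refine sum_congr rfl fun k hk => ?_
        rw [show r k = w * u k / N by linarith [h1 k hk]]
        ring
      have huu : ∑ k ∈ s, u k * u k = N ^ 2 := by
        rw [hu]
        exact sum_congr rfl fun k _ => by ring
      rw [hinner, hinner, huu]
      calc w / N * ∑ k ∈ s, u k * v k - w / N * N ^ 2
          ≤ w / N * (N * √(∑ k ∈ s, v k ^ 2)) - w / N * N ^ 2 := by gcongr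
        _ = w * (√(∑ k ∈ s, v k ^ 2) - N) := by field_simp
    · push Not at hne
      have hru : ∑ k ∈ s, r k * u k = 0 := sum_eq_zero fun k hk => by rw [hne k hk, mul_zero]
      have hN : ∑ k ∈ s, u k ^ 2 = 0 := sum_eq_zero fun k hk => by rw [hne k hk]; norm_num
      have hcs := Real.sum_mul_le_sqrt_mul_sqrt s r v
      have := mul_le_mul_of_nonneg_right (h2 hne) hv0
      rw [hru, hN, Real.sqrt_zero]
      linarith

/-- First-order optimality for the sum of a quadratic `F`, whose expansion at `b` has linear part
`-ℓ` and nonnegative second-order part `q`, and a convex function `P`. -/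
theorem quadratic_add_convex_min_iff {E : Type*} [AddCommGroup E] [Module ℝ E] {S : Set E}
    {F P ℓ q : E → ℝ} {b : E} (hP : ConvexOn ℝ S P) (hb : b ∈ S)
    (hF : ∀ x, F x = F b - ℓ (x - b) + q (x - b)) (hq : ∀ d, 0 ≤ q d)
    (hq_smul : ∀ (t : ℝ) d, q (t • d) = t ^ 2 * q d)
    (hl_smul : ∀ (t : ℝ) d, ℓ (t • d) = t * ℓ d) :
    (∀ x ∈ S, F b + P b ≤ F x + P x) ↔ ∀ x ∈ S, ℓ (x - b) ≤ P x - P b := by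
  constructor
  · intro h x hx
    have key (t : ℝ) (ht0 : 0 < t) (ht1 : t ≤ 1) : ℓ (x - b) ≤ P x - P b + t * q (x - b) := by
      have ht1' : 0 ≤ 1 - t := sub_nonneg.2 ht1
      have hmin := h _ (hP.1 hb hx ht1' ht0.le (by ring))
      have hconv := hP.2 hb hx ht1' ht0.le (by ring)
      have hd : (1 - t) • b + t • x - b = t • (x - b) := by module
      rw [hF (_ + _), hd, hq_smul, hl_smul] at hmin
      simp only [smul_eq_mul] at hconv
      refine le_of_mul_le_mul_left ?_ ht0
      linarith
    by_contra! hlt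
    have hq0 := hq (x - b)
    set a := ℓ (x - b) - (P x - P b)
    have ha : 0 < a := sub_pos.2 hlt
    have hden : 0 < a + 2 * q (x - b) := by linarith
    have := key (a / (a + 2 * q (x - b))) (by positivity) ((div_le_one hden).2 (by linarith))
    have h2 : a ≤ a / (a + 2 * q (x - b)) * q (x - b) := by simp only [a] at this ⊢; linarith
    rw [div_mul_eq_mul_div, le_div_iff₀ hden] at h2
    nlinarith
  · intro h x hx
    rw [hF x]
    linarith [h x hx, hq (x - b)]

open Finset in
/-- Exchange of coordinate and group sums for a replicated vector. -/
theorem sum_mul_sum_eq_sum_groups {ι κ : Type*} [Fintype ι] [Fintype κ] (J : κ → Finset ι)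
    (r : ι → ℝ) (d : ι → κ → ℝ) (hd : ∀ k j, k ∉ J j → d k j = 0) :
    ∑ k, r k * ∑ j, d k j = ∑ j, ∑ k ∈ J j, r k * d k j := by
  simp only [mul_sum]
  rw [sum_comm]
  refine sum_congr rfl fun j _ => (sum_subset (subset_univ _) fun k _ hk => ?_).symm
  rw [hd k j hk, mul_zero]

open Finset in
/-- A separable linear-versus-penalty inequality over replicated vectors holds iff it holds
group by group. -/
theorem replicated_subgradient_iff {ι κ : Type*} [Fintype ι] [Fintype κ] (J : κ → Finset ι)
    (w : κ → ℝ) (r : ι → ℝ) (b : ι → κ → ℝ) (hb : ∀ k j, k ∉ J j → b k j = 0) :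
    (∀ x : ι → κ → ℝ, (∀ k j, k ∉ J j → x k j = 0) →
      ∑ k, r k * ∑ j, (x - b) k j
        ≤ ∑ j, w j * √(∑ k ∈ J j, x k j ^ 2) - ∑ j, w j * √(∑ k ∈ J j, b k j ^ 2))
      ↔ ∀ g, ∀ v : ι → ℝ, ∑ k ∈ J g, r k * (v k - b k g)
        ≤ w g * (√(∑ k ∈ J g, v k ^ 2) - √(∑ k ∈ J g, b k g ^ 2)) := by
  classical
  have hswap (x : ι → κ → ℝ) (hx : ∀ k j, k ∉ J j → x k j = 0) :
      ∑ k, r k * ∑ j, (x - b) k j = ∑ j, ∑ k ∈ J j, r k * (x k j - b k j) :=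
    sum_mul_sum_eq_sum_groups J r (x - b) fun k j hk => by simp [hx k j hk, hb k j hk]
  constructor
  · intro h g v
    let x : ι → κ → ℝ := fun k j => if j = g ∧ k ∈ J j then v k else b k j
    have hx : ∀ k j, k ∉ J j → x k j = 0 := fun k j hk => by simp [x, hk, hb k j hk]
    have hxg : ∀ k ∈ J g, x k g = v k := fun k hk => by simp [x, hk]
    have hxj : ∀ j, j ≠ g → ∀ k, x k j = b k j := fun j hj k => by simp [x, hj]
    have hmain := h x hx
    rw [hswap x hx, ← sum_sub_distrib, sum_eq_single g, sum_eq_single g] at hmain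
    · have hlin : ∑ k ∈ J g, r k * (x k g - b k g) = ∑ k ∈ J g, r k * (v k - b k g) :=
        sum_congr rfl fun k hk => by rw [hxg k hk]
      have hsq : ∑ k ∈ J g, x k g ^ 2 = ∑ k ∈ J g, v k ^ 2 :=
        sum_congr rfl fun k hk => by rw [hxg k hk]
      rw [hlin, hsq] at hmain
      linarith
    · intro j _ hj
      simp [hxj j hj]
    · simp
    · intro j _ hj
      simp [hxj j hj]
    · simp
  · intro h x hx
    rw [hswap x hx, ← sum_sub_distrib]
    refine sum_le_sum fun j _ => ?_
    rw [← mul_sub]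
    exact h j fun k => x k j

open Finset in
/-- The group penalty is convex on replicated vectors. -/
theorem convexOn_group_penalty {ι κ : Type*} [Fintype κ] (J : κ → Finset ι) (w : κ → ℝ)
    (hw : ∀ j, 0 ≤ w j) :
    ConvexOn ℝ {x : ι → κ → ℝ | ∀ k j, k ∉ J j → x k j = 0}
      fun x => ∑ j, w j * √(∑ k ∈ J j, x k j ^ 2) := by
  refine ⟨fun x hx z hz a c _ _ _ k j hk => by simp [hx k j hk, hz k j hk], ?_⟩
  intro x _ z _ a c ha hc hac
  obtain rfl : a = 1 - c := by linarith
  simp only [smul_eq_mul, mul_sum, ← sum_add_distrib]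
  refine sum_le_sum fun j _ => ?_
  have hseg := sqrt_sum_sq_segment_le (J j) (fun k => x k j) (fun k => z k j) hc (by linarith)
  have e : ∑ k ∈ J j, ((1 - c) • x + c • z) k j ^ 2
      = ∑ k ∈ J j, (x k j + c * (z k j - x k j)) ^ 2 :=
    sum_congr rfl fun k _ => by simp only [Pi.add_apply, Pi.smul_apply, smul_eq_mul]; ring
  rw [e]
  linarith [mul_le_mul_of_nonneg_left hseg (hw j)]

open Finset in
/-- Second-order expansion of the least-squares loss around `b`. -/
theorem least_squares_expansion {m ι κ : Type*} [Fintype m] [Fintype ι] [Fintype κ]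
    (φ : Matrix m ι ℝ) (y : m → ℝ) (c : ℝ) (b x : ι → κ → ℝ) :
    c / 2 * ∑ i, (y i - ∑ k, (∑ j, x k j) * φ i k) ^ 2
      = c / 2 * ∑ i, (y i - ∑ k, (∑ j, b k j) * φ i k) ^ 2
        - ∑ k, (c * ∑ i, φ i k * (y i - ∑ l, (∑ j, b l j) * φ i l)) * ∑ j, (x - b) k j
        + c / 2 * ∑ i, (∑ k, (∑ j, (x - b) k j) * φ i k) ^ 2 := by
  have hlin : ∑ k, (c * ∑ i, φ i k * (y i - ∑ l, (∑ j, b l j) * φ i l)) * ∑ j, (x - b) k j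
      = c * ∑ i, (y i - ∑ l, (∑ j, b l j) * φ i l) * ∑ k, (∑ j, (x - b) k j) * φ i k := by
    generalize hd : (fun k => ∑ j, (x - b) k j) = d
    simp only [funext_iff] at hd
    simp only [hd, mul_sum, sum_mul]
    rw [sum_comm]
    exact sum_congr rfl fun i _ => sum_congr rfl fun k _ => by ring
  rw [hlin]
  simp only [mul_sum (s := (univ : Finset m)), ← sum_sub_distrib, ← sum_add_distrib]
  refine sum_congr rfl fun i _ => ?_
  have : ∑ k, (∑ j, (x - b) k j) * φ i k
      = ∑ k, (∑ j, x k j) * φ i k - ∑ k, (∑ j, b k j) * φ i k := by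
    simp only [Pi.sub_apply, sum_sub_distrib, sub_mul]
  rw [this]
  ring

/-- **KKT conditions for the overlapping group lasso (Proposition 1).**
A replicated coefficient vector `b` (with `b k j = 0` whenever variable `k` is not in
group `J j`), with induced vector `β k = ∑ j, b k j`, minimizes
`Q(b) = (1/(2n))‖y − φβ‖₂² + λ ∑_j √d_j ‖b_{J_j}‖₂`
iff for every group `g` with nonzero block and every `k ∈ J g`,
`−(1/n)ψ_kᵀ(y − φβ) + λ√d_g · b k g/‖b_{J_g}‖₂ = 0`, and for every group `g` with zero
block the vector `((1/n)ψ_kᵀ(y − φβ))_{k ∈ J g}` has Euclidean norm at most `λ√d_g`. -/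
theorem overlapping_group_lasso_KKT
    (n p pn : ℕ) (φ : Matrix (Fin n) (Fin p) ℝ) (y : Fin n → ℝ)
    (J : Fin pn → Finset (Fin p)) (hJ : ∀ k : Fin p, ∃ j, k ∈ J j)
    (lam : ℝ) (hlam : 0 < lam)
    (b : Fin p → Fin pn → ℝ) (hb0 : ∀ k j, k ∉ J j → b k j = 0) :
    (∀ b' : Fin p → Fin pn → ℝ, (∀ k j, k ∉ J j → b' k j = 0) →
      (1 / (2 * n)) * ∑ i, (y i - ∑ k, (∑ j, b k j) * φ i k) ^ 2
          + lam * ∑ j, Real.sqrt ((J j).card) * Real.sqrt (∑ k ∈ J j, (b k j) ^ 2)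
        ≤ (1 / (2 * n)) * ∑ i, (y i - ∑ k, (∑ j, b' k j) * φ i k) ^ 2
          + lam * ∑ j, Real.sqrt ((J j).card) * Real.sqrt (∑ k ∈ J j, (b' k j) ^ 2))
    ↔ ((∀ g : Fin pn, (∃ k ∈ J g, b k g ≠ 0) → ∀ k ∈ J g,
          -(1 / n) * ∑ i, φ i k * (y i - ∑ l, (∑ j, b l j) * φ i l)
            + lam * Real.sqrt ((J g).card) * b k g
                / Real.sqrt (∑ l ∈ J g, (b l g) ^ 2) = 0)
        ∧ (∀ g : Fin pn, (∀ k ∈ J g, b k g = 0) →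
          Real.sqrt (∑ k ∈ J g,
              ((1 / n) * ∑ i, φ i k * (y i - ∑ l, (∑ j, b l j) * φ i l)) ^ 2)
            ≤ lam * Real.sqrt ((J g).card))) := by
  have hw (j : Fin pn) : 0 ≤ lam * √((J j).card) := by positivity
  have hhalf : (1 / (2 * n) : ℝ) = 1 / n / 2 := by rw [div_div, mul_comm]
  have hpen (x : Fin p → Fin pn → ℝ) :
      lam * ∑ j, √((J j).card) * √(∑ k ∈ J j, x k j ^ 2)
        = ∑ j, lam * √((J j).card) * √(∑ k ∈ J j, x k j ^ 2) := by
    simp only [Finset.mul_sum, mul_assoc]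
  simp only [hhalf, hpen, neg_mul]
  rw [← forall_and]
  set r : Fin p → ℝ := fun k => 1 / n * ∑ i, φ i k * (y i - ∑ l, (∑ j, b l j) * φ i l)
  have hopt := quadratic_add_convex_min_iff
    (F := fun x : Fin p → Fin pn → ℝ =>
      1 / n / 2 * ∑ i, (y i - ∑ k, (∑ j, x k j) * φ i k) ^ 2)
    (ℓ := fun d => ∑ k, r k * ∑ j, d k j)
    (q := fun d => 1 / n / 2 * ∑ i, (∑ k, (∑ j, d k j) * φ i k) ^ 2)
    (convexOn_group_penalty J (fun j => lam * √((J j).card)) hw) hb0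
    (least_squares_expansion φ y (1 / n) b) (fun d => by positivity)
    (fun t d => by
      simp only [Pi.smul_apply, smul_eq_mul, ← Finset.mul_sum, mul_assoc, mul_pow]
      ring)
    (fun t d => by
      simp only [Pi.smul_apply, smul_eq_mul, ← Finset.mul_sum, mul_left_comm])
  refine hopt.trans ((replicated_subgradient_iff J _ r b hb0).trans ?_)
  exact forall_congr' fun g => subgradient_sqrt_sum_sq_iff (J g) (fun k => b k g) r (hw g)
end

section
/- In the overlapping group lasso setup, for every λ > 0 there exists a minimizer β̂^Z of the objective Q whose number of nonzero groups, |{j ∈ {1,…,p_n} : β̂_{J_j} ≠ 0}|, is at most n. -/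
/-- Conic Carathéodory reduction: a nonnegative combination in a finite-dimensional space can be
rewritten with at most `finrank` nonzero coefficients without increasing a nonnegative linear
cost. -/
theorem exists_nonneg_combination_ncard_support_le_finrank {ι V : Type*} [Fintype ι]
    [AddCommGroup V] [Module ℝ V] [FiniteDimensional ℝ V] (v : ι → V) (a : ι → ℝ)
    (ha : ∀ j, 0 ≤ a j) (t : ι → ℝ) (ht : ∀ j, 0 ≤ t j) :
    ∃ u : ι → ℝ, (∀ j, 0 ≤ u j) ∧ ∑ j, u j • v j = ∑ j, t j • v j ∧
      ∑ j, u j * a j ≤ ∑ j, t j * a j ∧ {j | u j ≠ 0}.ncard ≤ Module.finrank ℝ V := by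
  classical
  induction hm : {j | t j ≠ 0}.ncard using Nat.strong_induction_on generalizing t with
  | _ m ih =>
  by_cases hle : {j | t j ≠ 0}.ncard ≤ Module.finrank ℝ V
  · exact ⟨t, ht, rfl, le_rfl, hle⟩
  obtain ⟨c, hcS, hcv, i, hi⟩ : ∃ c : ι → ℝ, (∀ j, t j = 0 → c j = 0) ∧
      ∑ j, c j • v j = 0 ∧ ∃ j, c j ≠ 0 := by
    have hdep : ¬ LinearIndepOn ℝ v (Finset.univ.filter fun j => t j ≠ 0 : Finset ι) := by
      intro h
      apply hle
      have hcard := LinearIndependent.fintype_card_le_finrank h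
      simpa [Set.ncard_eq_toFinset_card', Fintype.card_subtype] using hcard
    rw [linearIndepOn_finset_iff] at hdep
    push Not at hdep
    obtain ⟨g, hg, i, hiS, hi⟩ := hdep
    refine ⟨fun j => if t j ≠ 0 then g j else 0, fun j hj => by simp [hj], ?_, i, ?_⟩
    · rw [← hg, Finset.sum_filter]
      simp only [ite_smul, zero_smul]
    · have : t i ≠ 0 := by simpa using hiS
      simpa [this] using hi
  obtain ⟨c, hcS, hcv, hca, i, hi⟩ : ∃ c : ι → ℝ, (∀ j, t j = 0 → c j = 0) ∧
      ∑ j, c j • v j = 0 ∧ ∑ j, c j * a j ≤ 0 ∧ ∃ j, c j ≠ 0 := by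
    rcases le_total (∑ j, c j * a j) 0 with h | h
    · exact ⟨c, hcS, hcv, h, i, hi⟩
    · exact ⟨-c, fun j hj => by simp [hcS j hj], by simp [hcv], by simpa using h, i, by simpa⟩
  obtain ⟨c, hcS, hcv, hca, j₀, hj₀⟩ : ∃ c : ι → ℝ, (∀ j, t j = 0 → c j = 0) ∧
      ∑ j, c j • v j = 0 ∧ ∑ j, c j * a j ≤ 0 ∧ ∃ j, c j < 0 := by
    by_cases hneg : ∃ j, c j < 0
    · exact ⟨c, hcS, hcv, hca, hneg⟩
    · push Not at hneg
      exact ⟨-c, fun j hj => by simp [hcS j hj], by simp [hcv],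
        by simpa using Finset.sum_nonneg fun j _ => mul_nonneg (hneg j) (ha j),
        i, by simpa using (hneg i).lt_of_ne' hi⟩
  obtain ⟨j₁, hj₁, hmin⟩ := (Finset.univ.filter fun j => c j < 0).exists_min_image
    (fun j => t j / -c j) ⟨j₀, by simpa using hj₀⟩
  replace hj₁ : c j₁ < 0 := by simpa using hj₁
  obtain ⟨s, hs⟩ : ∃ s, s = t j₁ / -c j₁ := ⟨_, rfl⟩
  have hs0 : 0 ≤ s := hs ▸ div_nonneg (ht _) (by linarith)
  have hnonneg : ∀ j, 0 ≤ t j + s * c j := by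
    intro j
    rcases le_or_gt 0 (c j) with hj | hj
    · exact add_nonneg (ht j) (mul_nonneg hs0 hj)
    · have hsj : s ≤ t j / -c j := hs ▸ hmin j (by simpa using hj)
      rw [le_div_iff₀ (by linarith)] at hsj
      linarith
  have hzero : t j₁ + s * c j₁ = 0 := by
    rw [hs]
    field_simp [hj₁.ne]
    ring
  have hlt : {j | t j + s * c j ≠ 0}.ncard < m := by
    rw [← hm]
    refine Set.ncard_lt_ncard ⟨fun j hj htj => hj (by simp [htj, hcS j htj]), fun hsub => ?_⟩
      (Set.toFinite _)
    exact hsub (show t j₁ ≠ 0 from fun h => hj₁.ne (hcS _ h)) hzero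
  obtain ⟨u, hu, huv, hua, hcard⟩ := ih _ hlt (fun j => t j + s * c j) hnonneg rfl
  refine ⟨u, hu, ?_, hua.trans ?_, hcard⟩
  · rw [huv]
    simp only [add_smul, mul_smul, Finset.sum_add_distrib, ← Finset.smul_sum, hcv, smul_zero,
      add_zero]
  · simp only [add_mul, mul_assoc, Finset.sum_add_distrib, ← Finset.mul_sum]
    linarith [mul_nonpos_of_nonneg_of_nonpos hs0 hca]

/-- The overlapping group lasso objective, as a function of the replicated coefficients. -/
noncomputable def groupLassoObjective {n p pn : ℕ} (φ : Matrix (Fin n) (Fin p) ℝ) (y : Fin n → ℝ)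
    (J : Fin pn → Finset (Fin p)) (lam : ℝ) (b : Fin p → Fin pn → ℝ) : ℝ :=
  (1 / (2 * n)) * ∑ i, (y i - ∑ k, (∑ j, b k j) * φ i k) ^ 2
    + lam * ∑ j, Real.sqrt ((J j).card) * Real.sqrt (∑ k ∈ J j, (b k j) ^ 2)

theorem continuous_groupLassoObjective {n p pn : ℕ} (φ : Matrix (Fin n) (Fin p) ℝ)
    (y : Fin n → ℝ) (J : Fin pn → Finset (Fin p)) (lam : ℝ) :
    Continuous (groupLassoObjective φ y J lam) := by
  unfold groupLassoObjective
  fun_prop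

theorem mul_abs_le_groupLassoObjective {n p pn : ℕ} (φ : Matrix (Fin n) (Fin p) ℝ)
    (y : Fin n → ℝ) (J : Fin pn → Finset (Fin p)) {lam : ℝ} (hlam : 0 ≤ lam)
    (b : Fin p → Fin pn → ℝ) {k : Fin p} {j : Fin pn} (hk : k ∈ J j) :
    lam * |b k j| ≤ groupLassoObjective φ y J lam b := by
  have hcard : 1 ≤ Real.sqrt ((J j).card) :=
    Real.one_le_sqrt.2 (by exact_mod_cast Finset.card_pos.2 ⟨k, hk⟩)
  have habs : |b k j| ≤ Real.sqrt (∑ k ∈ J j, (b k j) ^ 2) :=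
    Real.abs_le_sqrt (Finset.single_le_sum (f := fun k => (b k j) ^ 2)
      (fun _ _ => sq_nonneg _) hk)
  have hgroup : |b k j| ≤ ∑ j, Real.sqrt ((J j).card) * Real.sqrt (∑ k ∈ J j, (b k j) ^ 2) :=
    calc |b k j| ≤ Real.sqrt ((J j).card) * Real.sqrt (∑ k ∈ J j, (b k j) ^ 2) := by
          nlinarith [Real.sqrt_nonneg (∑ k ∈ J j, (b k j) ^ 2)]
      _ ≤ _ := Finset.single_le_sum
          (f := fun j => Real.sqrt ((J j).card) * Real.sqrt (∑ k ∈ J j, (b k j) ^ 2))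
          (fun _ _ => by positivity) (Finset.mem_univ j)
  have hfit : 0 ≤ (1 / (2 * n) : ℝ) * ∑ i, (y i - ∑ k, (∑ j, b k j) * φ i k) ^ 2 := by positivity
  unfold groupLassoObjective
  linarith [mul_le_mul_of_nonneg_left hgroup hlam]

theorem exists_groupLassoObjective_minimizer {n p pn : ℕ} (φ : Matrix (Fin n) (Fin p) ℝ)
    (y : Fin n → ℝ) (J : Fin pn → Finset (Fin p)) {lam : ℝ} (hlam : 0 < lam) :
    ∃ b : Fin p → Fin pn → ℝ, (∀ k j, k ∉ J j → b k j = 0) ∧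
      ∀ b' : Fin p → Fin pn → ℝ, (∀ k j, k ∉ J j → b' k j = 0) →
        groupLassoObjective φ y J lam b ≤ groupLassoObjective φ y J lam b' := by
  set R := groupLassoObjective φ y J lam 0 / lam with hR
  have hR0 : 0 ≤ R := div_nonneg (by unfold groupLassoObjective; positivity) hlam.le
  set K : Set (Fin p → Fin pn → ℝ) := Set.univ.pi fun k => Set.univ.pi fun j =>
    if k ∈ J j then Set.Icc (-R) R else {0} with hK
  have hKc : IsCompact K := isCompact_univ_pi fun k => isCompact_univ_pi fun j => by
    split_ifs
    exacts [isCompact_Icc, isCompact_singleton]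
  have h0 : (0 : Fin p → Fin pn → ℝ) ∈ K := by
    simp only [hK, Set.mem_univ_pi]
    intro k j
    split_ifs <;> simp [hR0]
  obtain ⟨b, hb, hmin⟩ := hKc.exists_isMinOn ⟨0, h0⟩
    (continuous_groupLassoObjective φ y J lam).continuousOn
  simp only [hK, Set.mem_univ_pi] at hb
  refine ⟨b, fun k j hkj => by simpa [hkj] using hb k j, fun b' hb' => ?_⟩
  rcases le_total (groupLassoObjective φ y J lam 0) (groupLassoObjective φ y J lam b') with h | h
  · exact (hmin h0).trans h
  · refine hmin (show b' ∈ K from ?_)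
    simp only [hK, Set.mem_univ_pi]
    intro k j
    split_ifs with hkj
    · rw [Set.mem_Icc, ← abs_le, hR, le_div_iff₀ hlam, mul_comm]
      exact (mul_abs_le_groupLassoObjective φ y J hlam.le b' hkj).trans h
    · simpa using hb' k j hkj

/-- Rescaling groups by nonnegative factors that preserve the fit and do not increase the weighted
sum of group norms does not increase the objective. -/
theorem groupLassoObjective_rescale_le {n p pn : ℕ} (φ : Matrix (Fin n) (Fin p) ℝ)
    (y : Fin n → ℝ) (J : Fin pn → Finset (Fin p)) {lam : ℝ} (hlam : 0 ≤ lam)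
    (b : Fin p → Fin pn → ℝ) (u : Fin pn → ℝ) (hu : ∀ j, 0 ≤ u j)
    (hfit : ∀ i, ∑ j, u j * ∑ k, b k j * φ i k = ∑ j, ∑ k, b k j * φ i k)
    (hpen : ∑ j, u j * (Real.sqrt ((J j).card) * Real.sqrt (∑ k ∈ J j, (b k j) ^ 2))
      ≤ ∑ j, Real.sqrt ((J j).card) * Real.sqrt (∑ k ∈ J j, (b k j) ^ 2)) :
    groupLassoObjective φ y J lam (fun k j => u j * b k j) ≤ groupLassoObjective φ y J lam b := by
  have hfit' : ∀ i, ∑ k, (∑ j, u j * b k j) * φ i k = ∑ k, (∑ j, b k j) * φ i k := by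
    intro i
    simp only [Finset.sum_mul]
    rw [Finset.sum_comm, Finset.sum_comm (f := fun k j => b k j * φ i k), ← hfit i]
    simp only [Finset.mul_sum, mul_assoc]
  have hnorm : ∀ j, Real.sqrt (∑ k ∈ J j, (u j * b k j) ^ 2)
      = u j * Real.sqrt (∑ k ∈ J j, (b k j) ^ 2) := by
    intro j
    simp only [mul_pow, ← Finset.mul_sum]
    rw [Real.sqrt_mul (sq_nonneg _), Real.sqrt_sq (hu j)]
  unfold groupLassoObjective
  simp only [hfit', hnorm, mul_left_comm _ (u _)]
  gcongr


/-- **Sparsity of overlapping group lasso solutions (Lemma 2).**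
For every `λ > 0` there is a minimizer of the overlapping group lasso objective
`Q(b) = (1/(2n))‖y − φβ‖₂² + λ ∑_j √d_j ‖b_{J_j}‖₂` (over replicated coefficient
vectors `b`, with induced vector `β k = ∑ j, b k j`) having at most `n` nonzero groups. -/
theorem overlapping_group_lasso_sparse_minimizer
    (n p pn : ℕ) (φ : Matrix (Fin n) (Fin p) ℝ) (y : Fin n → ℝ)
    (J : Fin pn → Finset (Fin p)) (hJ : ∀ k : Fin p, ∃ j, k ∈ J j)
    (lam : ℝ) (hlam : 0 < lam) :
    ∃ b : Fin p → Fin pn → ℝ,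
      (∀ k j, k ∉ J j → b k j = 0)
      ∧ (∀ b' : Fin p → Fin pn → ℝ, (∀ k j, k ∉ J j → b' k j = 0) →
          (1 / (2 * n)) * ∑ i, (y i - ∑ k, (∑ j, b k j) * φ i k) ^ 2
              + lam * ∑ j, Real.sqrt ((J j).card) * Real.sqrt (∑ k ∈ J j, (b k j) ^ 2)
            ≤ (1 / (2 * n)) * ∑ i, (y i - ∑ k, (∑ j, b' k j) * φ i k) ^ 2
              + lam * ∑ j, Real.sqrt ((J j).card) * Real.sqrt (∑ k ∈ J j, (b' k j) ^ 2))
      ∧ Set.ncard {j : Fin pn | ∃ k ∈ J j, b k j ≠ 0} ≤ n := by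
  obtain ⟨b, hb, hmin⟩ := exists_groupLassoObjective_minimizer φ y J hlam
  obtain ⟨u, hu, hfit, hpen, hcard⟩ := exists_nonneg_combination_ncard_support_le_finrank
    (fun j i => ∑ k, b k j * φ i k)
    (fun j => Real.sqrt ((J j).card) * Real.sqrt (∑ k ∈ J j, (b k j) ^ 2))
    (fun _ => by positivity) (fun _ => 1) (fun _ => zero_le_one)
  simp only [one_mul, one_smul] at hfit hpen
  refine ⟨fun k j => u j * b k j, fun k j hkj => by simp [hb k j hkj], fun b' hb' => ?_, ?_⟩
  · exact (groupLassoObjective_rescale_le φ y J hlam.le b u hu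
      (fun i => by simpa using congrFun hfit i) hpen).trans (hmin b' hb')
  · rw [Module.finrank_fin_fun] at hcard
    refine (Set.ncard_le_ncard ?_ (Set.toFinite _)).trans hcard
    rintro j ⟨_, _, h⟩
    exact left_ne_zero_of_mul h
end

section
/- In the overlapping group lasso setup with λ > 0, let β̂^Z be a minimizer of Q with induced vector β̂ ∈ ℝ^p. Then for every variable i ∈ {1,…,p} and any two groups j, j' containing i, the corresponding replicated coefficients satisfy β̂_{ij} · β̂_{ij'} ≥ 0. Consequently, for every i, Σ_{j : i∈J_j} β̂_{ij}² ≤ (Σ_{j : i∈J_j} β̂_{ij})² = β̂_i², and hence ‖β̂^Z‖₂ ≤ ‖β̂‖₂, where ‖β̂^Z‖₂ is the Euclidean norm of the full replicated vector. -/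
theorem sum_sq_le_sq_sum_of_mul_nonneg {ι : Type*} (s : Finset ι) (f : ι → ℝ)
    (h : ∀ j ∈ s, ∀ l ∈ s, 0 ≤ f j * f l) : ∑ j ∈ s, f j ^ 2 ≤ (∑ j ∈ s, f j) ^ 2 := by
  rw [sq (∑ j ∈ s, f j), Finset.sum_mul_sum]
  refine Finset.sum_le_sum fun j hj => ?_
  rw [sq]
  exact Finset.single_le_sum (f := fun l => f j * f l) (fun l hl => h j hj l hl) hj

/-- Move mass `c` from entry `(i, j')` to entry `(i, j)`. -/
def transferCoeff {p m : ℕ} (b : Fin p → Fin m → ℝ) (i : Fin p) (j j' : Fin m) (c : ℝ) :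
    Fin p → Fin m → ℝ := fun k l =>
  b k l + (if k = i ∧ l = j then c else 0) - (if k = i ∧ l = j' then c else 0)

theorem sum_transferCoeff {p m : ℕ} (b : Fin p → Fin m → ℝ) (i : Fin p) (j j' : Fin m) (c : ℝ)
    (k : Fin p) : ∑ l, transferCoeff b i j j' c k l = ∑ l, b k l := by
  by_cases hk : k = i <;>
    simp [transferCoeff, hk, Finset.sum_add_distrib, Finset.sum_sub_distrib]

/-- Cancelling the smaller of two entries of opposite sign into the larger one strictly decreases
a positively weighted sum of group norms. -/
theorem sum_group_norm_transferCoeff_lt {p m : ℕ} (J : Fin m → Finset (Fin p))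
    (b : Fin p → Fin m → ℝ) {i : Fin p} {j j' : Fin m} (hj : i ∈ J j)
    (hneg : b i j * b i j' < 0) (hle : b i j' ^ 2 ≤ b i j ^ 2) :
    ∑ l, √((J l).card) * √(∑ k ∈ J l, transferCoeff b i j j' (b i j') k l ^ 2) <
      ∑ l, √((J l).card) * √(∑ k ∈ J l, b k l ^ 2) := by
  have hjj : j ≠ j' := by
    rintro rfl
    exact absurd hneg (not_lt.2 (mul_self_nonneg _))
  have hlt : transferCoeff b i j j' (b i j') i j ^ 2 < b i j ^ 2 := by
    simp only [transferCoeff, hjj, and_self, and_false, if_true, if_false]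
    nlinarith
  have hsq : ∀ k l, transferCoeff b i j j' (b i j') k l ^ 2 ≤ b k l ^ 2 := by
    intro k l
    by_cases h : k = i ∧ l = j
    · obtain ⟨rfl, rfl⟩ := h
      exact hlt.le
    · by_cases h' : k = i ∧ l = j'
      · obtain ⟨rfl, rfl⟩ := h'
        simp [transferCoeff, hjj.symm, sq_nonneg]
      · simp [transferCoeff, h, h']
  refine Finset.sum_lt_sum (fun l _ => ?_) ⟨j, Finset.mem_univ _, ?_⟩
  · exact mul_le_mul_of_nonneg_left
      (Real.sqrt_le_sqrt (Finset.sum_le_sum fun k _ => hsq k l)) (Real.sqrt_nonneg _)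
  · refine mul_lt_mul_of_pos_left (Real.sqrt_lt_sqrt (Finset.sum_nonneg fun _ _ => sq_nonneg _)
      (Finset.sum_lt_sum (fun k _ => hsq k j) ⟨i, hj, hlt⟩)) (Real.sqrt_pos.2 ?_)
    exact_mod_cast Finset.card_pos.2 ⟨i, hj⟩


/-- **Sign alignment of replicated coefficients at an overlapping group lasso minimum.**
If `b` (zero-filled outside the groups) minimizes the overlapping group lasso objective
with `λ > 0`, then for every variable `i` and groups `j, j'` containing `i`, one has
`b i j * b i j' ≥ 0`; consequently `∑_{j : i ∈ J j} (b i j)² ≤ (∑_{j : i ∈ J j} b i j)² = β̂ i²`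
for every `i`, and `‖b‖₂ ≤ ‖β̂‖₂` for the induced vector `β̂ k = ∑ j, b k j`. -/
theorem overlapping_group_lasso_sign_alignment
    (n p pn : ℕ) (φ : Matrix (Fin n) (Fin p) ℝ) (y : Fin n → ℝ)
    (J : Fin pn → Finset (Fin p)) (hJ : ∀ k : Fin p, ∃ j, k ∈ J j)
    (lam : ℝ) (hlam : 0 < lam)
    (b : Fin p → Fin pn → ℝ) (hb0 : ∀ k j, k ∉ J j → b k j = 0)
    (hmin : ∀ b' : Fin p → Fin pn → ℝ, (∀ k j, k ∉ J j → b' k j = 0) →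
      (1 / (2 * n)) * ∑ i, (y i - ∑ k, (∑ j, b k j) * φ i k) ^ 2
          + lam * ∑ j, Real.sqrt ((J j).card) * Real.sqrt (∑ k ∈ J j, (b k j) ^ 2)
        ≤ (1 / (2 * n)) * ∑ i, (y i - ∑ k, (∑ j, b' k j) * φ i k) ^ 2
          + lam * ∑ j, Real.sqrt ((J j).card) * Real.sqrt (∑ k ∈ J j, (b' k j) ^ 2)) :
    (∀ i : Fin p, ∀ j j' : Fin pn, i ∈ J j → i ∈ J j' → 0 ≤ b i j * b i j')
    ∧ (∀ i : Fin p,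
        (∑ j ∈ Finset.univ.filter (fun j => i ∈ J j), (b i j) ^ 2)
          ≤ (∑ j ∈ Finset.univ.filter (fun j => i ∈ J j), b i j) ^ 2
        ∧ (∑ j ∈ Finset.univ.filter (fun j => i ∈ J j), b i j) ^ 2 = (∑ j, b i j) ^ 2)
    ∧ Real.sqrt (∑ i, ∑ j, (b i j) ^ 2) ≤ Real.sqrt (∑ i, (∑ j, b i j) ^ 2) := by
  have key : ∀ i : Fin p, ∀ j j' : Fin pn, i ∈ J j → i ∈ J j' → b i j' ^ 2 ≤ b i j ^ 2 →
      0 ≤ b i j * b i j' := by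
    intro i j j' hj hj' hle
    by_contra! hneg
    have hm := hmin (transferCoeff b i j j' (b i j')) (by
      intro k l hkl
      have h1 : ¬(k = i ∧ l = j) := by
        rintro ⟨rfl, rfl⟩
        exact hkl hj
      have h2 : ¬(k = i ∧ l = j') := by
        rintro ⟨rfl, rfl⟩
        exact hkl hj'
      simp [transferCoeff, h1, h2, hb0 k l hkl])
    simp only [sum_transferCoeff] at hm
    have hlt := mul_lt_mul_of_pos_left (sum_group_norm_transferCoeff_lt J b hj hneg hle) hlam
    linarith
  have sign : ∀ i : Fin p, ∀ j j' : Fin pn, i ∈ J j → i ∈ J j' → 0 ≤ b i j * b i j' := by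
    intro i j j' hj hj'
    rcases le_total (b i j' ^ 2) (b i j ^ 2) with h | h
    · exact key i j j' hj hj' h
    · rw [mul_comm]
      exact key i j' j hj' hj h
  refine ⟨sign, fun i => ⟨?_, ?_⟩, ?_⟩
  · exact sum_sq_le_sq_sum_of_mul_nonneg _ _ fun j hj l hl =>
      sign i j l (Finset.mem_filter.1 hj).2 (Finset.mem_filter.1 hl).2
  · rw [Finset.sum_filter_of_ne]
    intro j _ hne
    by_contra h
    exact hne (hb0 i j h)
  · refine Real.sqrt_le_sqrt (Finset.sum_le_sum fun i _ =>
      sum_sq_le_sq_sum_of_mul_nonneg _ _ fun j _ l _ => ?_)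
    by_cases hj : i ∈ J j
    · by_cases hl : i ∈ J l
      · exact sign i j l hj hl
      · simp [hb0 i l hl]
    · simp [hb0 i j hj]
end

section
/- In the overlapping group lasso setup, let γ^Z be a replicated coefficient vector with induced vector γ ∈ ℝ^p, let T ⊆ {1,…,p_n} with |T| = s_n, and let d̄ = max_j d_j. Suppose (i) Σ_{t∉T} √d_t ‖γ^Z_{J_t}‖₂ ≤ Σ_{t∈T} √d_t ‖γ^Z_{J_t}‖₂, and (ii) ‖γ^Z‖₂ ≤ ‖γ‖₂, where ‖γ^Z‖₂ is the Euclidean norm of the full replicated vector. Then Σ_{t=1}^{p_n} √d_t ‖γ^Z_{J_t}‖₂ ≤ 2√(s_n d̄) ‖γ‖₂. -/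
/-- **Block-norm bound for replicated vectors (display (A.6) in the paper).**
Let `γZ` be a replicated coefficient vector (zero-filled outside its groups) with induced
vector `γ k = ∑ j, γZ k j`, let `T` be a set of groups with `|T| = s_n`, and
`d̄ = max_j d_j`.  If the off-`T` weighted block norms are dominated by the on-`T` ones and
`‖γZ‖₂ ≤ ‖γ‖₂`, then `∑_t √d_t ‖γZ_{J_t}‖₂ ≤ 2 √(s_n d̄) ‖γ‖₂`. -/
theorem replicated_block_norm_bound
    (p pn : ℕ) (J : Fin pn → Finset (Fin p)) (hJ : ∀ k : Fin p, ∃ j, k ∈ J j)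
    (γZ : Fin p → Fin pn → ℝ) (hγ0 : ∀ k j, k ∉ J j → γZ k j = 0)
    (T : Finset (Fin pn)) (sn : ℕ) (hsn : sn = T.card)
    (dbar : ℕ) (hdbar : dbar = Finset.univ.sup (fun j => (J j).card))
    (h1 : ∑ t ∈ Tᶜ, Real.sqrt ((J t).card) * Real.sqrt (∑ k ∈ J t, (γZ k t) ^ 2)
        ≤ ∑ t ∈ T, Real.sqrt ((J t).card) * Real.sqrt (∑ k ∈ J t, (γZ k t) ^ 2))
    (h2 : Real.sqrt (∑ k, ∑ j, (γZ k j) ^ 2)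
        ≤ Real.sqrt (∑ k, (∑ j, γZ k j) ^ 2)) :
    ∑ t, Real.sqrt ((J t).card) * Real.sqrt (∑ k ∈ J t, (γZ k t) ^ 2)
      ≤ 2 * Real.sqrt (sn * dbar) * Real.sqrt (∑ k, (∑ j, γZ k j) ^ 2) := by
  have hcs := Real.sum_sqrt_mul_sqrt_le T (f := fun t => ((J t).card : ℝ))
    (g := fun t => ∑ k ∈ J t, (γZ k t) ^ 2) (fun t => by positivity) (fun t => by positivity)
  have hcard : ∑ t ∈ T, ((J t).card : ℝ) ≤ sn * dbar := by
    rw [hsn, ← nsmul_eq_mul]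
    refine Finset.sum_le_card_nsmul T _ _ fun t _ => ?_
    rw [hdbar]
    exact_mod_cast Finset.le_sup (f := fun j => (J j).card) (Finset.mem_univ t)
  have hsq : ∑ t ∈ T, ∑ k ∈ J t, (γZ k t) ^ 2 ≤ ∑ k, ∑ j, (γZ k j) ^ 2 := by
    rw [Finset.sum_comm (s := Finset.univ)]
    calc ∑ t ∈ T, ∑ k ∈ J t, (γZ k t) ^ 2
        ≤ ∑ t ∈ T, ∑ k, (γZ k t) ^ 2 := Finset.sum_le_sum fun t _ =>
          Finset.sum_le_sum_of_subset_of_nonneg (Finset.subset_univ _)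
            fun _ _ _ => sq_nonneg _
      _ ≤ ∑ t, ∑ k, (γZ k t) ^ 2 :=
          Finset.sum_le_sum_of_subset_of_nonneg (Finset.subset_univ _)
            fun _ _ _ => Finset.sum_nonneg fun _ _ => sq_nonneg _
  have hT := hcs.trans (mul_le_mul (Real.sqrt_le_sqrt hcard)
    ((Real.sqrt_le_sqrt hsq).trans h2) (Real.sqrt_nonneg _) (Real.sqrt_nonneg _))
  rw [← Finset.sum_add_sum_compl T]
  linarith
end

section
/- In the overlapping group lasso setup, let β*^Z be a fixed replicated vector, let T ⊆ {1,…,p_n} contain every group that has a variable with nonzero induced coefficient of β*, s_n = |T|, c̄ = max_k |{j : k ∈ J_j}|, d̄ = max_j d_j, and C = (1/n)φᵀφ. Let γ^Z (with induced γ) satisfy: (a) f(γ, γ^Z) := n γᵀCγ + λ Σ_{t∉T} √d_t ‖γ^Z_{J_t}‖₂ + λ Σ_{t∈T} √d_t (‖γ^Z_{J_t} + β*^Z_{J_t}‖₂ − ‖β*^Z_{J_t}‖₂) ≤ 0; (b) ‖γ^Z‖₂ ≤ ‖γ‖₂; (c) γ^Z has at most n nonzero groups. Assume moreover, with u_n =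 s_n log n: φ_min(u_n d̄) ≥ κ_min/2, φ_max(n d̄) ≤ κ_max, 4d̄ < log n, and D := √((κ_min/2)(1 − 4d̄/log n)) − √(2κ_max d̄²/log n) > 0. Then ‖γ‖₂ ≤ λ √(c̄ s_n d̄) / (n D²). -/
/-- Any finite type has a subset of prescribed size carrying the largest values of `f`. -/
lemma exists_card_eq_forall_le_of_notMem {ι : Type*} [Fintype ι] [DecidableEq ι] (f : ι → ℝ)
    (m : ℕ) (hm : m ≤ Fintype.card ι) :
    ∃ U : Finset ι, U.card = m ∧ ∀ i ∈ U, ∀ j ∉ U, f j ≤ f i := by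
  induction m with
  | zero => exact ⟨∅, by simp, by simp⟩
  | succ m ih =>
    obtain ⟨U, hU, hle⟩ := ih (by omega)
    have hne : (Uᶜ).Nonempty := by
      rw [← Finset.card_pos, Finset.card_compl]
      omega
    obtain ⟨a, ha, hmax⟩ := Finset.exists_max_image Uᶜ f hne
    rw [Finset.mem_compl] at ha
    refine ⟨insert a U, by rw [Finset.card_insert_of_notMem ha, hU], fun i hi j hj => ?_⟩
    have hj' : j ∉ U := fun h => hj (Finset.mem_insert_of_mem h)
    rcases Finset.mem_insert.mp hi with rfl | hi
    · exact hmax j (Finset.mem_compl.mpr hj')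
    · exact hle i hi j hj'

/-- Best `m`-term approximation: outside the `m` largest entries the squared `ℓ²` norm is at most
the squared `ℓ¹` norm divided by `4m`. -/
lemma exists_card_le_four_mul_sum_compl_sq_le {ι : Type*} [Fintype ι] [DecidableEq ι] (v : ι → ℝ)
    (m : ℕ) :
    ∃ U : Finset ι, U.card ≤ m ∧ 4 * m * ∑ k ∈ Uᶜ, v k ^ 2 ≤ (∑ k, |v k|) ^ 2 := by
  rcases le_total (Fintype.card ι) m with hm | hm
  · exact ⟨Finset.univ, by simpa using hm, by simpa using sq_nonneg _⟩
  obtain ⟨U, hU, hle⟩ := exists_card_eq_forall_le_of_notMem (fun k => |v k|) m hm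
  refine ⟨U, hU.le, ?_⟩
  rcases (Uᶜ).eq_empty_or_nonempty with he | hne
  · simpa [he] using sq_nonneg _
  obtain ⟨a, ha, hmax⟩ := Finset.exists_max_image Uᶜ (fun k => |v k|) hne
  rw [Finset.mem_compl] at ha
  have hS : m * |v a| ≤ ∑ k ∈ U, |v k| := by
    rw [← hU, ← nsmul_eq_mul]
    exact Finset.card_nsmul_le_sum U _ _ fun i hi => hle i hi a ha
  have hR : ∑ k ∈ Uᶜ, v k ^ 2 ≤ |v a| * ∑ k ∈ Uᶜ, |v k| := by
    rw [Finset.mul_sum]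
    refine Finset.sum_le_sum fun k hk => ?_
    rw [← sq_abs, sq]
    exact mul_le_mul_of_nonneg_right (hmax k hk) (abs_nonneg _)
  have hR0 : 0 ≤ ∑ k ∈ Uᶜ, |v k| := Finset.sum_nonneg fun _ _ => abs_nonneg _
  rw [← Finset.sum_add_sum_compl U (fun k => |v k|)]
  have h1 := mul_le_mul_of_nonneg_right hS hR0
  have h2 := mul_le_mul_of_nonneg_left hR (Nat.cast_nonneg (α := ℝ) m)
  nlinarith [sq_nonneg (∑ k ∈ U, |v k| - ∑ k ∈ Uᶜ, |v k|)]

/-- Triangle inequality for the Euclidean norm over a finset, in the form `‖b‖ - ‖g + b‖ ≤ ‖g‖`. -/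
lemma sqrt_sum_sq_sub_sqrt_sum_add_sq_le {ι : Type*} (s : Finset ι) (g b : ι → ℝ) :
    √(∑ k ∈ s, b k ^ 2) - √(∑ k ∈ s, (g k + b k) ^ 2) ≤ √(∑ k ∈ s, g k ^ 2) := by
  have hA : 0 ≤ ∑ k ∈ s, (g k + b k) ^ 2 := Finset.sum_nonneg fun _ _ => sq_nonneg _
  have hB : 0 ≤ ∑ k ∈ s, g k ^ 2 := Finset.sum_nonneg fun _ _ => sq_nonneg _
  rw [sub_le_iff_le_add]
  refine Real.sqrt_le_iff.mpr ⟨by positivity, ?_⟩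
  have hcs := Real.sum_mul_le_sqrt_mul_sqrt s (fun k => g k + b k) (fun k => -g k)
  simp only [neg_sq] at hcs
  have hexp : ∑ k ∈ s, b k ^ 2 = ∑ k ∈ s, (g k + b k) ^ 2 + ∑ k ∈ s, g k ^ 2
      + 2 * ∑ k ∈ s, (g k + b k) * -g k := by
    rw [Finset.mul_sum, ← Finset.sum_add_distrib, ← Finset.sum_add_distrib]
    exact Finset.sum_congr rfl fun _ _ => by ring
  rw [add_sq, Real.sq_sqrt hA, Real.sq_sqrt hB]
  linarith

/-- The Gram quadratic form is the squared norm of the normalised image. -/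
lemma gram_quadratic_form_eq_norm_sq {n p : ℕ} (φ : Matrix (Fin n) (Fin p) ℝ) (v : Fin p → ℝ) :
    ∑ k, ∑ l, v k * ((1 / n) * ∑ i, φ i k * φ i l) * v l
      = ‖√(1 / (n : ℝ)) • WithLp.toLp 2 (φ.mulVec v)‖ ^ 2 := by
  rw [norm_smul, mul_pow, Real.norm_eq_abs, sq_abs, Real.sq_sqrt (by positivity),
    EuclideanSpace.norm_sq_eq]
  have h : ∀ i, ‖(WithLp.toLp 2 (φ.mulVec v) : EuclideanSpace ℝ (Fin n)) i‖ ^ 2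
      = ∑ k, ∑ l, (φ i k * v k) * (φ i l * v l) := fun i => by
    rw [Real.norm_eq_abs, sq_abs, ← Finset.sum_mul_sum, sq]
    rfl
  simp only [h]
  rw [Finset.sum_comm (s := (Finset.univ : Finset (Fin n))), Finset.mul_sum]
  refine Finset.sum_congr rfl fun k _ => ?_
  rw [Finset.sum_comm, Finset.mul_sum]
  refine Finset.sum_congr rfl fun l _ => ?_
  rw [Finset.mul_sum, Finset.mul_sum, Finset.sum_mul, Finset.mul_sum]
  exact Finset.sum_congr rfl fun i _ => by ring

/-- The `ℓ¹` norm of the induced vector is bounded by the weighted group norm. -/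
lemma sum_abs_sum_le_sum_sqrt_card_mul {ι τ : Type*} [Fintype ι] [Fintype τ] (J : τ → Finset ι)
    (g : ι → τ → ℝ) (hg : ∀ k j, k ∉ J j → g k j = 0) :
    ∑ k, |∑ j, g k j| ≤ ∑ t, √((J t).card) * √(∑ k ∈ J t, g k t ^ 2) := by
  calc ∑ k, |∑ j, g k j| ≤ ∑ k, ∑ j, |g k j| :=
        Finset.sum_le_sum fun k _ => Finset.abs_sum_le_sum_abs _ _
    _ = ∑ j, ∑ k, |g k j| := Finset.sum_comm
    _ ≤ _ := by
        refine Finset.sum_le_sum fun t _ => ?_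
        have h := Real.sum_mul_le_sqrt_mul_sqrt (J t) (fun _ => (1 : ℝ)) (fun k => |g k t|)
        simp only [one_mul, one_pow, sq_abs, Finset.sum_const, nsmul_eq_mul, mul_one] at h
        rwa [Finset.sum_subset (Finset.subset_univ (J t))
          (fun k _ hk => by rw [hg k t hk, abs_zero])] at h

/-- Cauchy–Schwarz over a set `T` of groups of size at most `d`. -/
lemma sum_sqrt_card_mul_le {ι τ : Type*} [Fintype ι] [Fintype τ] (J : τ → Finset ι)
    (g : ι → τ → ℝ) (T : Finset τ) (d : ℕ) (hd : ∀ t, (J t).card ≤ d) :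
    ∑ t ∈ T, √((J t).card) * √(∑ k ∈ J t, g k t ^ 2)
      ≤ √(T.card * d) * √(∑ k, ∑ j, g k j ^ 2) := by
  refine (Real.sum_sqrt_mul_sqrt_le T (fun t => Nat.cast_nonneg _)
    (fun t => Finset.sum_nonneg fun _ _ => sq_nonneg _)).trans ?_
  gcongr
  · rw [← nsmul_eq_mul]
    exact Finset.sum_le_card_nsmul _ _ _ fun t _ => by exact_mod_cast hd t
  · rw [Finset.sum_comm]
    calc ∑ t ∈ T, ∑ k ∈ J t, g k t ^ 2 ≤ ∑ t ∈ T, ∑ k, g k t ^ 2 :=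
          Finset.sum_le_sum fun t _ => Finset.sum_le_sum_of_subset_of_nonneg
            (Finset.subset_univ _) fun _ _ _ => sq_nonneg _
      _ ≤ ∑ t, ∑ k, g k t ^ 2 := Finset.sum_le_sum_of_subset_of_nonneg
            (Finset.subset_univ _) fun _ _ _ => Finset.sum_nonneg fun _ _ => sq_nonneg _

/-- The support of the induced vector lies in the union of the nonzero groups. -/
lemma ncard_support_sum_le {ι τ : Type*} [Fintype ι] [Fintype τ] (J : τ → Finset ι)
    (g : ι → τ → ℝ) (hg : ∀ k j, k ∉ J j → g k j = 0) (d : ℕ) (hd : ∀ t, (J t).card ≤ d) :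
    Set.ncard {k | ∑ j, g k j ≠ 0} ≤ Set.ncard {t | ∃ k ∈ J t, g k t ≠ 0} * d := by
  classical
  set A : Finset τ := Finset.univ.filter fun t => ∃ k ∈ J t, g k t ≠ 0 with hA
  have hA' : {t | ∃ k ∈ J t, g k t ≠ 0} = (A : Set τ) := by simp [hA]
  have hsub : {k | ∑ j, g k j ≠ 0} ⊆ ((A.biUnion J : Finset ι) : Set ι) := by
    intro k hk
    obtain ⟨j, -, hj⟩ := Finset.exists_ne_zero_of_sum_ne_zero hk
    have hkj : k ∈ J j := by
      by_contra h
      exact hj (hg k j h)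
    exact Finset.mem_coe.mpr (Finset.mem_biUnion.mpr ⟨j, by simpa [hA] using ⟨k, hkj, hj⟩, hkj⟩)
  rw [hA', Set.ncard_coe_finset]
  refine (Set.ncard_le_ncard hsub (Finset.finite_toSet _)).trans ?_
  rw [Set.ncard_coe_finset]
  exact Finset.card_biUnion_le_card_mul _ _ _ fun t _ => hd t


/-- **Bound on the de-noised coefficient perturbation (Lemma 1 / `boundGamma`).**
With `C = (1/n)φᵀφ`, groups `J`, replicated vectors `γZ` (inducing `γ`) and `β*Z`,
a set `T` of groups containing all groups touching the support of the induced `β*`,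
`s_n = |T|`, `c̄` the maximal number of groups a variable belongs to, `d̄` the maximal
group size, and `u_n = s_n log n`: if `f(γ, γZ) ≤ 0`, `‖γZ‖₂ ≤ ‖γ‖₂`, `γZ` has at most
`n` nonzero groups, the `u_n d̄`-sparse minimal eigenvalue of `C` is at least `κ_min/2`,
the `n d̄`-sparse maximal eigenvalue is at most `κ_max`, `4d̄ < log n`, and
`D = √((κ_min/2)(1 − 4d̄/log n)) − √(2κ_max d̄²/log n) > 0`, then
`‖γ‖₂ ≤ λ √(c̄ s_n d̄)/(n D²)`. -/
theorem denoised_gamma_bound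
    (n p pn : ℕ) (φ : Matrix (Fin n) (Fin p) ℝ)
    (J : Fin pn → Finset (Fin p)) (hJ : ∀ k : Fin p, ∃ j, k ∈ J j)
    (lam : ℝ) (hlam : 0 < lam)
    (βZ γZ : Fin p → Fin pn → ℝ)
    (hβ0 : ∀ k j, k ∉ J j → βZ k j = 0) (hγ0 : ∀ k j, k ∉ J j → γZ k j = 0)
    (T : Finset (Fin pn))
    (hT : ∀ t : Fin pn, (∃ k ∈ J t, (∑ j, βZ k j) ≠ 0) → t ∈ T)
    (sn : ℕ) (hsn : sn = T.card)
    (dbar : ℕ) (hdbar : dbar = Finset.univ.sup (fun j => (J j).card))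
    (cbar : ℕ)
    (hcbar : cbar = Finset.univ.sup
      (fun k : Fin p => (Finset.univ.filter (fun j => k ∈ J j)).card))
    (κmin κmax : ℝ) (hκmin : 0 < κmin) (hκmax : 0 < κmax)
    -- (a) `f(γ, γZ) ≤ 0`
    (ha : (n : ℝ) * ∑ k, ∑ l, (∑ j, γZ k j)
            * ((1 / n) * ∑ i, φ i k * φ i l) * (∑ j, γZ l j)
        + lam * ∑ t ∈ Tᶜ, Real.sqrt ((J t).card)
            * Real.sqrt (∑ k ∈ J t, (γZ k t) ^ 2)
        + lam * ∑ t ∈ T, Real.sqrt ((J t).card)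
            * (Real.sqrt (∑ k ∈ J t, (γZ k t + βZ k t) ^ 2)
              - Real.sqrt (∑ k ∈ J t, (βZ k t) ^ 2)) ≤ 0)
    -- (b) `‖γZ‖₂ ≤ ‖γ‖₂`
    (hb : Real.sqrt (∑ k, ∑ j, (γZ k j) ^ 2)
        ≤ Real.sqrt (∑ k, (∑ j, γZ k j) ^ 2))
    -- (c) at most `n` nonzero groups
    (hc : Set.ncard {t : Fin pn | ∃ k ∈ J t, γZ k t ≠ 0} ≤ n)
    -- `φ_min(u_n d̄) ≥ κ_min/2` with `u_n = s_n log n`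
    (hmin : ∀ v : Fin p → ℝ,
      (Set.ncard {k | v k ≠ 0} : ℝ) ≤ (sn : ℝ) * Real.log n * dbar →
      κmin / 2 * ∑ k, (v k) ^ 2
        ≤ ∑ k, ∑ l, v k * ((1 / n) * ∑ i, φ i k * φ i l) * v l)
    -- `φ_max(n d̄) ≤ κ_max`
    (hmax : ∀ v : Fin p → ℝ,
      (Set.ncard {k | v k ≠ 0} : ℝ) ≤ (n : ℝ) * dbar →
      ∑ k, ∑ l, v k * ((1 / n) * ∑ i, φ i k * φ i l) * v l
        ≤ κmax * ∑ k, (v k) ^ 2)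
    (hlog : 4 * (dbar : ℝ) < Real.log n)
    (D : ℝ)
    (hD : D = Real.sqrt (κmin / 2 * (1 - 4 * dbar / Real.log n))
        - Real.sqrt (2 * κmax * (dbar : ℝ) ^ 2 / Real.log n))
    (hDpos : 0 < D) :
    Real.sqrt (∑ k, (∑ j, γZ k j) ^ 2)
      ≤ lam * Real.sqrt ((cbar : ℝ) * sn * dbar) / (n * D ^ 2) := by
  set γ : Fin p → ℝ := fun k => ∑ j, γZ k j with hγ
  set L : (Fin p → ℝ) → EuclideanSpace ℝ (Fin n) :=
    fun v => √(1 / (n : ℝ)) • WithLp.toLp 2 (φ.mulVec v) with hL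
  have hq : ∀ v : Fin p → ℝ,
      ∑ k, ∑ l, v k * ((1 / n) * ∑ i, φ i k * φ i l) * v l = ‖L v‖ ^ 2 :=
    gram_quadratic_form_eq_norm_sq φ
  have hd : ∀ t, (J t).card ≤ dbar := fun t => by
    rw [hdbar]
    exact Finset.le_sup (f := fun j => (J j).card) (Finset.mem_univ t)
  change (n : ℝ) * ∑ k, ∑ l, γ k * ((1 / n) * ∑ i, φ i k * φ i l) * γ l + _ + _ ≤ 0 at ha
  change √(∑ k, γ k ^ 2) ≤ _
  change _ ≤ √(∑ k, γ k ^ 2) at hb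
  rw [hq] at ha
  simp only [hq] at hmin hmax
  rcases (Real.sqrt_nonneg (∑ k, γ k ^ 2)).eq_or_lt with hG0 | hGpos
  · rw [← hG0]
    positivity
  set G : ℝ := √(∑ k, γ k ^ 2) with hG
  have hGsq : G ^ 2 = ∑ k, γ k ^ 2 := Real.sq_sqrt (Finset.sum_nonneg fun _ _ => sq_nonneg _)
  obtain ⟨k₀⟩ : Nonempty (Fin p) := by
    by_contra h
    rw [not_nonempty_iff] at h
    simp [hG] at hGpos
  obtain ⟨j₀, hj₀⟩ := hJ k₀
  have hd1 : 1 ≤ dbar := le_trans (Finset.card_pos.mpr ⟨k₀, hj₀⟩) (hd j₀)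
  have hd1R : (1 : ℝ) ≤ dbar := by exact_mod_cast hd1
  have hc1 : 1 ≤ cbar := by
    rw [hcbar]
    refine le_trans ?_ (Finset.le_sup
      (f := fun k : Fin p => (Finset.univ.filter (fun j => k ∈ J j)).card) (Finset.mem_univ k₀))
    exact Finset.card_pos.mpr ⟨j₀, by simpa using hj₀⟩
  have hc1R : (1 : ℝ) ≤ cbar := by exact_mod_cast hc1
  have hlogpos : 0 < Real.log n := by linarith
  have hnpos : (0 : ℝ) < n := by
    rcases Nat.eq_zero_or_pos n with h | h
    · simp [h] at hlogpos
    · exact_mod_cast h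
  set S₁ : ℝ := ∑ t ∈ T, √((J t).card) * √(∑ k ∈ J t, γZ k t ^ 2) with hS₁
  set S₂ : ℝ := ∑ t ∈ Tᶜ, √((J t).card) * √(∑ k ∈ J t, γZ k t ^ 2) with hS₂
  have hS₂0 : 0 ≤ S₂ := Finset.sum_nonneg fun _ _ => by positivity
  have hS₁le : S₁ ≤ √(sn * dbar) * G := by
    rw [hsn]
    exact (sum_sqrt_card_mul_le J γZ T dbar hd).trans
      (mul_le_mul_of_nonneg_left hb (Real.sqrt_nonneg _))
  have hbasic : n * ‖L γ‖ ^ 2 + lam * S₂ ≤ lam * S₁ := by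
    have h : -S₁ ≤ ∑ t ∈ T, √((J t).card) * (√(∑ k ∈ J t, (γZ k t + βZ k t) ^ 2)
        - √(∑ k ∈ J t, βZ k t ^ 2)) := by
      rw [hS₁, ← Finset.sum_neg_distrib]
      refine Finset.sum_le_sum fun t _ => ?_
      rw [← mul_neg]
      refine mul_le_mul_of_nonneg_left ?_ (Real.sqrt_nonneg _)
      linarith [sqrt_sum_sq_sub_sqrt_sum_add_sq_le (J t) (fun k => γZ k t) (fun k => βZ k t)]
    have := mul_le_mul_of_nonneg_left h hlam.le
    linarith
  have hS₂₁ : S₂ ≤ S₁ := by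
    refine le_of_mul_le_mul_left ?_ hlam
    have : 0 ≤ n * ‖L γ‖ ^ 2 := by positivity
    linarith
  have hl1 : ∑ k, |γ k| ≤ 2 * (√(sn * dbar) * G) := by
    refine (sum_abs_sum_le_sum_sqrt_card_mul J γZ hγ0).trans ?_
    rw [← Finset.sum_add_sum_compl T]
    linarith
  have hl1sq : (∑ k, |γ k|) ^ 2 ≤ 4 * (sn * dbar) * G ^ 2 := by
    have h := pow_le_pow_left₀ (Finset.sum_nonneg fun _ _ => abs_nonneg _) hl1 2
    rw [mul_pow, mul_pow, Real.sq_sqrt (by positivity)] at h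
    linarith
  have hs1 : (1 : ℝ) ≤ sn := by
    have : sn ≠ 0 := by
      rintro h0
      obtain ⟨k, -, hk⟩ : ∃ k ∈ Finset.univ, γ k ^ 2 ≠ 0 :=
        Finset.exists_ne_zero_of_sum_ne_zero (by rw [← hGsq]; positivity)
      have h1 : |γ k| ≤ 0 := by
        refine (Finset.single_le_sum (f := fun k => |γ k|) (fun _ _ => abs_nonneg _)
          (Finset.mem_univ k)).trans ?_
        simpa [h0] using hl1
      exact hk (by rw [abs_nonpos_iff.mp h1]; norm_num)
    exact_mod_cast Nat.one_le_iff_ne_zero.mpr this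
  set m : ℕ := ⌊(sn : ℝ) * Real.log n * dbar⌋₊ with hm
  have hmle : (m : ℝ) ≤ sn * Real.log n * dbar := Nat.floor_le (by positivity)
  have hmge : 3 / 4 * (sn * Real.log n * dbar) ≤ m := by
    have h1 := Nat.lt_floor_add_one ((sn : ℝ) * Real.log n * dbar)
    have h2 : (1 : ℝ) * 4 * 1 ≤ sn * Real.log n * dbar := by
      gcongr
      linarith
    linarith
  obtain ⟨U, hUcard, hUtail⟩ := exists_card_le_four_mul_sum_compl_sq_le γ m
  set R : ℝ := ∑ k ∈ Uᶜ, γ k ^ 2 with hR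
  have hR0 : 0 ≤ R := Finset.sum_nonneg fun _ _ => sq_nonneg _
  have hRle : R ≤ 2 / Real.log n * G ^ 2 := by
    rw [div_mul_eq_mul_div, le_div_iff₀ hlogpos]
    have h1 : 4 * (3 / 4 * (sn * Real.log n * dbar)) * R ≤ 4 * m * R := by gcongr
    have h2 : (sn * dbar) * (3 * (R * Real.log n)) ≤ (sn * dbar) * (4 * G ^ 2) := by linarith
    have h3 := le_of_mul_le_mul_left h2 (by positivity)
    linarith [sq_nonneg G, mul_nonneg hR0 hlogpos.le]
  set vU : Fin p → ℝ := fun k => if k ∈ U then γ k else 0 with hvU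
  set vR : Fin p → ℝ := fun k => if k ∈ U then 0 else γ k with hvR
  have hLadd : L γ = L vU + L vR := by
    have : γ = vU + vR := by
      ext k
      by_cases h : k ∈ U <;> simp [hvU, hvR, h]
    rw [this]
    simp only [hL, Matrix.mulVec_add, WithLp.toLp_add, smul_add]
  have hvUsq : ∑ k, vU k ^ 2 = G ^ 2 - R := by
    rw [hGsq, hR, ← Finset.sum_add_sum_compl U (fun k => γ k ^ 2), add_sub_cancel_right]
    simp [hvU, ite_pow, Finset.sum_ite_mem]
  have hvRsq : ∑ k, vR k ^ 2 = R := by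
    rw [← Finset.sum_add_sum_compl U, hR,
      Finset.sum_eq_zero (fun k hk => by simp [hvR, hk]), zero_add]
    exact Finset.sum_congr rfl fun k hk => by simp [hvR, Finset.mem_compl.mp hk]
  have hlow : √(κmin / 2 * (1 - 4 * dbar / Real.log n)) * G ≤ ‖L vU‖ := by
    have hcard : (Set.ncard {k | vU k ≠ 0} : ℝ) ≤ (sn : ℝ) * Real.log n * dbar := by
      refine le_trans ?_ hmle
      have hsub : {k | vU k ≠ 0} ⊆ (U : Set (Fin p)) := fun k hk => by
        by_contra h
        exact hk (if_neg h)
      have := Set.ncard_le_ncard hsub (Finset.finite_toSet _)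
      rw [Set.ncard_coe_finset] at this
      exact_mod_cast this.trans hUcard
    have h := hmin vU hcard
    rw [hvUsq] at h
    rw [← Real.sqrt_sq hGpos.le, ← Real.sqrt_mul' _ (sq_nonneg G)]
    refine Real.sqrt_le_iff.mpr ⟨norm_nonneg _, le_trans ?_ h⟩
    rw [mul_assoc]
    refine mul_le_mul_of_nonneg_left ?_ (by positivity)
    have h24 : 2 / Real.log n ≤ 4 * dbar / Real.log n := by
      gcongr
      linarith
    rw [sub_mul, one_mul]
    linarith [mul_le_mul_of_nonneg_right h24 (sq_nonneg G)]
  have hupp : ‖L vR‖ ≤ √(2 * κmax * (dbar : ℝ) ^ 2 / Real.log n) * G := by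
    have hcard : (Set.ncard {k | vR k ≠ 0} : ℝ) ≤ (n : ℝ) * dbar := by
      have hsub : {k | vR k ≠ 0} ⊆ {k | ∑ j, γZ k j ≠ 0} := fun k hk h0 => by
        refine hk ?_
        by_cases h : k ∈ U
        · simp [hvR, h]
        · simpa [hvR, h] using h0
      have h1 := (Set.ncard_le_ncard hsub (Set.toFinite _)).trans
        ((ncard_support_sum_le J γZ hγ0 dbar hd).trans (Nat.mul_le_mul_right _ hc))
      exact_mod_cast h1
    have h := hmax vR hcard
    rw [hvRsq] at h
    rw [← Real.sqrt_sq hGpos.le, ← Real.sqrt_mul' _ (sq_nonneg G)]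
    refine Real.le_sqrt_of_sq_le (h.trans ?_)
    have hd2 : (1 : ℝ) ≤ (dbar : ℝ) ^ 2 := one_le_pow₀ hd1R
    calc κmax * R ≤ κmax * (2 / Real.log n * G ^ 2) * 1 := by
          rw [mul_one]
          gcongr
      _ ≤ κmax * (2 / Real.log n * G ^ 2) * (dbar : ℝ) ^ 2 := by gcongr
      _ = _ := by ring
  have hDG : D * G ≤ ‖L γ‖ := by
    have h := norm_sub_le (L vU + L vR) (L vR)
    rw [add_sub_cancel_right, ← hLadd] at h
    rw [hD, sub_mul]
    linarith
  have hDGsq : (D * G) ^ 2 ≤ ‖L γ‖ ^ 2 := pow_le_pow_left₀ (by positivity) hDG 2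
  have hfinal : n * (D * G) ^ 2 ≤ lam * (√(sn * dbar) * G) := by
    have h1 := mul_le_mul_of_nonneg_left hDGsq hnpos.le
    have h2 := mul_le_mul_of_nonneg_left hS₁le hlam.le
    have h3 := mul_nonneg hlam.le hS₂0
    linarith
  have hcs : √(sn * dbar) ≤ √(cbar * sn * dbar) := by
    refine Real.sqrt_le_sqrt ?_
    rw [mul_assoc]
    exact le_mul_of_one_le_left (by positivity) hc1R
  rw [le_div_iff₀ (by positivity)]
  refine le_of_mul_le_mul_right ?_ hGpos
  have h := mul_le_mul_of_nonneg_right (mul_le_mul_of_nonneg_left hcs hlam.le) hGpos.le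
  linarith
end

section
/- Let φ ∈ ℝ^{n×p}, ε, B ∈ ℝ^n, and m̄ ∈ ℕ with 1 ≤ m̄ ≤ p. For each M ⊆ {1,…,p} with |M| ≤ m̄ and φ_M (the submatrix of the columns indexed by M) of full column rank, define θ^M = (φ_Mᵀφ_M)⁻¹ φ_Mᵀ(ε + B). Suppose ‖φᵀε‖_∞ ≤ C₁√(n log p), ‖φᵀB‖_∞ ≤ C₂√(n log p), and φ_min(m̄) > 0. Then max over all such M of ‖θ^M‖₂² is at most 2(C₁² + C₂²) m̄ (log p) / (n φ_min(m̄)²). -/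
open Matrix

/-- A sum over a fintype of a function vanishing off `M` is a sum over the subtype of `M`. -/
lemma sum_eq_sum_subtype_of_eq_zero {κ : Type*} [Fintype κ] (M : Finset κ) (f : κ → ℝ)
    (hf : ∀ k, k ∉ M → f k = 0) : ∑ k, f k = ∑ k : {k // k ∈ M}, f k.val := by
  rw [Finset.sum_coe_sort M f]
  exact (Finset.sum_subset (Finset.subset_univ M) fun k _ hk => hf k hk).symm

/-- If `c‖x‖² ≤ ⟨x, b⟩` with `c > 0`, then `c²‖x‖² ≤ ‖b‖²`. -/
lemma sq_mul_sum_sq_le_of_le_sum_mul {κ : Type*} [Fintype κ] (x b : κ → ℝ) {c : ℝ} (hc : 0 < c)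
    (h : c * ∑ k, x k ^ 2 ≤ ∑ k, x k * b k) : c ^ 2 * ∑ k, x k ^ 2 ≤ ∑ k, b k ^ 2 := by
  have hsq : 0 ≤ ∑ k, (c * x k - b k) ^ 2 := Finset.sum_nonneg fun k _ => sq_nonneg _
  have hexp : ∑ k, (c * x k - b k) ^ 2
      = c ^ 2 * ∑ k, x k ^ 2 - 2 * c * ∑ k, x k * b k + ∑ k, b k ^ 2 := by
    rw [Finset.mul_sum, Finset.mul_sum, ← Finset.sum_sub_distrib, ← Finset.sum_add_distrib]
    exact Finset.sum_congr rfl fun k _ => by ring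
  nlinarith [mul_le_mul_of_nonneg_left h hc.le]

/-- The quadratic form of a Gram matrix, written with explicit sums. -/
lemma sum_mul_gram_mul {ι κ : Type*} [Fintype ι] [Fintype κ] (A : Matrix ι κ ℝ) (x : κ → ℝ)
    (c : ℝ) :
    ∑ k, ∑ l, x k * (c * ∑ i, A i k * A i l) * x l = c * ∑ k, x k * ((Aᵀ * A) *ᵥ x) k := by
  simp only [Matrix.mulVec, dotProduct, Matrix.mul_apply, Matrix.transpose_apply, Finset.mul_sum]
  refine Finset.sum_congr rfl fun k _ => Finset.sum_congr rfl fun l _ => ?_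
  simp only [← Finset.mul_sum]
  ring

/-- **Bound on the restricted least-squares estimators (Lemma 3).**
For `φ ∈ ℝ^{n×p}`, `ε, B ∈ ℝ^n` with `‖φᵀε‖_∞ ≤ C₁√(n log p)` and
`‖φᵀB‖_∞ ≤ C₂√(n log p)`, and `φ_min(m̄) ≥ φmin > 0`, every restricted least-squares
estimator `θ^M = (φ_Mᵀφ_M)⁻¹φ_Mᵀ(ε + B)` over a column set `M` with `|M| ≤ m̄`
and `φ_M` of full column rank satisfies
`‖θ^M‖₂² ≤ 2(C₁² + C₂²) m̄ log p / (n φmin²)`. -/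
theorem restricted_ols_bound
    (n p : ℕ) (φ : Matrix (Fin n) (Fin p) ℝ) (ε B : Fin n → ℝ)
    (mbar : ℕ) (hmbar1 : 1 ≤ mbar) (hmbarp : mbar ≤ p)
    (C₁ C₂ : ℝ)
    (hε : ∀ k : Fin p, |∑ i, φ i k * ε i| ≤ C₁ * Real.sqrt (n * Real.log p))
    (hB : ∀ k : Fin p, |∑ i, φ i k * B i| ≤ C₂ * Real.sqrt (n * Real.log p))
    (φmin : ℝ) (hφminpos : 0 < φmin)
    (hφmin : ∀ v : Fin p → ℝ, (Set.ncard {k | v k ≠ 0} ≤ mbar) →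
      φmin * ∑ k, (v k) ^ 2
        ≤ ∑ k, ∑ l, v k * ((1 / n) * ∑ i, φ i k * φ i l) * v l) :
    ∀ M : Finset (Fin p), M.card ≤ mbar →
      ∀ _hrank : IsUnit
        (((Matrix.of fun (i : Fin n) (k : {k : Fin p // k ∈ M}) => φ i k.val)ᵀ
          * Matrix.of fun (i : Fin n) (k : {k : Fin p // k ∈ M}) => φ i k.val).det),
      (∑ k : {k : Fin p // k ∈ M},
        ((((Matrix.of fun (i : Fin n) (k : {k : Fin p // k ∈ M}) => φ i k.val)ᵀ
            * Matrix.of fun (i : Fin n) (k : {k : Fin p // k ∈ M}) => φ i k.val)⁻¹).mulVec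
          ((Matrix.of fun (i : Fin n) (k : {k : Fin p // k ∈ M}) => φ i k.val)ᵀ.mulVec
            (fun i => ε i + B i)) k) ^ 2)
      ≤ 2 * (C₁ ^ 2 + C₂ ^ 2) * mbar * Real.log p / (n * φmin ^ 2) := by
  intro M hM hrank
  have hn : (0 : ℝ) < n := by
    rcases Nat.eq_zero_or_pos n with rfl | hn
    · have h := hφmin (Pi.single ⟨0, by omega⟩ 1) (by
        refine le_trans (le_of_eq ?_) hmbar1
        rw [Set.ncard_eq_one]
        exact ⟨⟨0, by omega⟩, by ext k; simp [Pi.single_apply]⟩)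
      simp [Pi.single_apply] at h
      linarith
    · exact_mod_cast hn
  have hlog : 0 ≤ Real.log p := Real.log_natCast_nonneg p
  set A := Matrix.of fun (i : Fin n) (k : {k : Fin p // k ∈ M}) => φ i k.val with hA
  set b := Aᵀ *ᵥ fun i => ε i + B i with hb
  set θ := (Aᵀ * A)⁻¹ *ᵥ b with hθ
  have hnormal : (Aᵀ * A) *ᵥ θ = b := by
    rw [hθ, Matrix.mulVec_mulVec, Matrix.mul_nonsing_inv _ hrank, Matrix.one_mulVec]
  have hbk (k) : b k ^ 2 ≤ 2 * (C₁ ^ 2 + C₂ ^ 2) * (n * Real.log p) := by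
    have hsplit : b k = ∑ i, φ i k.val * ε i + ∑ i, φ i k.val * B i := by
      simp [hb, hA, Matrix.mulVec, dotProduct, mul_add, Finset.sum_add_distrib]
    have habs : |b k| ≤ (C₁ + C₂) * √(n * Real.log p) := by
      rw [hsplit, add_mul]
      exact (abs_add_le _ _).trans (add_le_add (hε k) (hB k))
    calc b k ^ 2 = |b k| ^ 2 := (sq_abs _).symm
      _ ≤ ((C₁ + C₂) * √(n * Real.log p)) ^ 2 := pow_le_pow_left₀ (abs_nonneg _) habs 2
      _ = (C₁ + C₂) ^ 2 * (n * Real.log p) := by rw [mul_pow, Real.sq_sqrt (by positivity)]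
      _ ≤ 2 * (C₁ ^ 2 + C₂ ^ 2) * (n * Real.log p) := by gcongr; exact add_sq_le
  have hbsum : ∑ k, b k ^ 2 ≤ mbar * (2 * (C₁ ^ 2 + C₂ ^ 2) * (n * Real.log p)) := by
    refine (Finset.sum_le_sum fun k _ => hbk k).trans ?_
    rw [Finset.sum_const, nsmul_eq_mul, Finset.card_univ, Fintype.card_coe]
    gcongr
  have hquad : φmin * ∑ k, θ k ^ 2 ≤ (1 / n) * ∑ k, θ k * b k := by
    let v : Fin p → ℝ := fun k => if h : k ∈ M then θ ⟨k, h⟩ else 0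
    have hv0 (k) (hk : k ∉ M) : v k = 0 := dif_neg hk
    have hvM (k : {k // k ∈ M}) : v k.val = θ k := dif_pos k.2
    have hsupp : Set.ncard {k | v k ≠ 0} ≤ mbar := by
      refine le_trans ?_ hM
      rw [← Set.ncard_coe_finset M]
      exact Set.ncard_le_ncard (fun k hk => by_contra fun h => hk (hv0 k h)) M.finite_toSet
    have h := hφmin v hsupp
    rw [sum_eq_sum_subtype_of_eq_zero M _ fun k hk => by simp [hv0 k hk],
      sum_eq_sum_subtype_of_eq_zero M _ fun k hk => by simp [hv0 k hk]] at h
    have hinner (k : Fin p) : ∑ l, v k * ((1 / n) * ∑ i, φ i k * φ i l) * v l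
        = ∑ l : {l // l ∈ M}, v k * ((1 / n) * ∑ i, φ i k * φ i l.val) * v l.val :=
      sum_eq_sum_subtype_of_eq_zero M _ fun l hl => by simp [hv0 l hl]
    simp only [hinner] at h
    simp only [hvM] at h
    exact h.trans_eq ((sum_mul_gram_mul A θ (1 / n)).trans (by rw [hnormal]))
  have hscaled : (n * φmin) * ∑ k, θ k ^ 2 ≤ ∑ k, θ k * b k := by
    rw [one_div, inv_mul_eq_div, le_div_iff₀ hn] at hquad
    linarith
  have hfinal := (sq_mul_sum_sq_le_of_le_sum_mul θ b (mul_pos hn hφminpos) hscaled).trans hbsum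
  rw [le_div_iff₀ (by positivity)]
  refine le_of_mul_le_mul_left ?_ hn
  linarith
end

section
/- Let ℓ : ℝ × ℝ^{p−1} → ℝ be twice continuously differentiable. For w ∈ ℝ^{p−1} define the decorrelated score S_w(β₁, β₋₁) = ∂_{β₁}ℓ(β₁, β₋₁) − wᵀ∇_{β₋₁}ℓ(β₁, β₋₁). Let β̂₋₁, β*₋₁ ∈ ℝ^{p−1} and ŵ, w* ∈ ℝ^{p−1} be arbitrary, and set η₁ = ‖β̂₋₁ − β*₋₁‖₂, η₂ = ‖ŵ − w*‖₁, η₃ = ‖∇_{β₋₁}ℓ(0, β*₋₁)‖_∞, and η₄ = sup_{ν∈[0,1]} ‖∇²_{β₁β₋₁}ℓ(0, β_ν) − ∇²_{β₋₁β₋₁}ℓ(0, β_ν) ŵ‖₂ where β_ν = ν β*₋₁ + (1−ν) β̂₋₁. Then |S_{ŵ}(0, β̂₋₁) − S_{w*}(0, β*₋₁)| ≤ η₂ η₃ + η₁ η₄. -/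
theorem ContinuousLinearMap.sum_mul_apply_single {m : ℕ} (f : (Fin m → ℝ) →L[ℝ] ℝ)
    (w : Fin m → ℝ) : ∑ j, w j * f (Pi.single j 1) = f w := by
  conv_rhs => rw [pi_eq_sum_univ' w, map_sum]
  refine Finset.sum_congr rfl fun j _ => ?_
  simp

theorem ContDiff.fderiv_fderiv_apply_comm {E : Type*} [NormedAddCommGroup E] [NormedSpace ℝ E]
    {f : E → ℝ} (hf : ContDiff ℝ 2 f) (x u w : E) :
    fderiv ℝ (fun v => fderiv ℝ f v u) x w = fderiv ℝ (fun v => fderiv ℝ f v w) x u := by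
  have hd : DifferentiableAt ℝ (fderiv ℝ f) x :=
    (hf.fderiv_right (m := 1) (by norm_num)).differentiable (by norm_num) x
  have key (a b : E) :
      fderiv ℝ (fun v => fderiv ℝ f v a) x b = fderiv ℝ (fderiv ℝ f) x b a := by
    rw [fderiv_clm_apply hd (differentiableAt_const a)]
    simp
  rw [key, key]
  exact (hf.contDiffAt.isSymmSndFDerivAt (by simp)).eq w u

/-- The partial derivative of a `C²` function in its first variable is `C¹` in the second. -/
theorem ContDiff.contDiff_deriv_fst {E : Type*} [NormedAddCommGroup E] [NormedSpace ℝ E]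
    {f : ℝ → E → ℝ} (hf : ContDiff ℝ 2 (fun z : ℝ × E => f z.1 z.2)) (a : ℝ) :
    ContDiff ℝ 1 (fun v => deriv (fun t => f t v) a) := by
  have h (v : E) : deriv (fun t => f t v) a =
      fderiv ℝ (fun z : ℝ × E => f z.1 z.2) (a, v) (1, 0) := by
    have hc : HasDerivAt (fun t : ℝ => (t, v)) ((1 : ℝ), (0 : E)) a :=
      (hasDerivAt_id a).prodMk (hasDerivAt_const a v)
    exact ((hf.differentiable (by norm_num) (a, v)).hasFDerivAt.comp_hasDerivAt a hc).deriv
  simp_rw [h]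
  exact ((hf.fderiv_right (m := 1) (by norm_num)).comp
    (contDiff_const.prodMk contDiff_id)).clm_apply contDiff_const

/-- The mean value theorem along the segment from `y` to `x`. -/
theorem Differentiable.exists_fderiv_eq_sub {m : ℕ} {H : (Fin m → ℝ) → ℝ}
    (hH : Differentiable ℝ H) (x y : Fin m → ℝ) :
    ∃ ν ∈ Set.Icc (0 : ℝ) 1,
      fderiv ℝ H (fun i => ν * x i + (1 - ν) * y i) (x - y) = H x - H y := by
  let γ : ℝ → Fin m → ℝ := fun ν i => ν * x i + (1 - ν) * y i
  have hγ (ν : ℝ) : HasDerivAt γ (x - y) ν := by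
    refine hasDerivAt_pi.2 fun i => ?_
    have h := ((hasDerivAt_id ν).mul_const (x i)).add
      (((hasDerivAt_id ν).const_sub 1).mul_const (y i))
    refine h.congr_deriv ?_
    simp only [Pi.sub_apply]
    ring
  have hd (ν : ℝ) : HasDerivAt (H ∘ γ) (fderiv ℝ H (γ ν) (x - y)) ν :=
    (hH (γ ν)).hasFDerivAt.comp_hasDerivAt ν (hγ ν)
  obtain ⟨ν, hν, h⟩ := exists_hasDerivAt_eq_slope (H ∘ γ) _ zero_lt_one
    (fun t _ => (hd t).continuousAt.continuousWithinAt) (fun t _ => hd t)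
  refine ⟨ν, Set.Ioo_subset_Icc_self hν, ?_⟩
  simpa [γ] using h

theorem Finset.abs_sum_mul_le_sqrt_mul_sqrt {ι : Type*} (s : Finset ι) (f g : ι → ℝ) :
    |∑ i ∈ s, f i * g i| ≤ √(∑ i ∈ s, f i ^ 2) * √(∑ i ∈ s, g i ^ 2) := by
  rw [← Real.sqrt_mul (Finset.sum_nonneg fun i _ => sq_nonneg (f i))]
  exact Real.abs_le_sqrt (Finset.sum_mul_sq_le_sq_mul_sq s f g)

/-- **Stability of the decorrelated score (Theorem 3.5-type bound).**
For a `C²` loss `ℓ(β₁, β₋₁)` and the decorrelated score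
`S_w(β₁, β₋₁) = ∂_{β₁}ℓ − wᵀ∇_{β₋₁}ℓ`, the difference between the plug-in score
`S_{ŵ}(0, β̂₋₁)` and the ideal score `S_{w*}(0, β*₋₁)` is bounded by
`η₂η₃ + η₁η₄`, where `η₁ = ‖β̂₋₁ − β*₋₁‖₂`, `η₂ = ‖ŵ − w*‖₁`,
`η₃ ≥ ‖∇_{β₋₁}ℓ(0, β*₋₁)‖_∞`, and `η₄` bounds, uniformly over `ν ∈ [0,1]`,
`‖∇²_{β₁β₋₁}ℓ(0, β_ν) − ∇²_{β₋₁β₋₁}ℓ(0, β_ν)ŵ‖₂` along `β_ν = νβ*₋₁ + (1−ν)β̂₋₁`. -/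
theorem decorrelated_score_stability
    (m : ℕ) (ℓ : ℝ → (Fin m → ℝ) → ℝ)
    (hℓ : ContDiff ℝ 2 (fun z : ℝ × (Fin m → ℝ) => ℓ z.1 z.2))
    (βh βs wh ws : Fin m → ℝ)
    (η₁ η₂ η₃ η₄ : ℝ)
    (hη₁ : η₁ = Real.sqrt (∑ j, (βh j - βs j) ^ 2))
    (hη₂ : η₂ = ∑ j, |wh j - ws j|)
    (hη₃ : ∀ j, |fderiv ℝ (ℓ 0) βs (Pi.single j 1)| ≤ η₃)
    (hη₄ : ∀ ν ∈ Set.Icc (0 : ℝ) 1,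
      Real.sqrt (∑ j,
        (fderiv ℝ (fun v => deriv (fun t => ℓ t v) 0)
            (fun i => ν * βs i + (1 - ν) * βh i) (Pi.single j 1)
          - fderiv ℝ (fun v => fderiv ℝ (ℓ 0) v (Pi.single j 1))
            (fun i => ν * βs i + (1 - ν) * βh i) wh) ^ 2) ≤ η₄) :
    |(deriv (fun t => ℓ t βh) 0 - ∑ j, wh j * fderiv ℝ (ℓ 0) βh (Pi.single j 1))
      - (deriv (fun t => ℓ t βs) 0 - ∑ j, ws j * fderiv ℝ (ℓ 0) βs (Pi.single j 1))|
    ≤ η₂ * η₃ + η₁ * η₄ := by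
  have hf : ContDiff ℝ 2 (ℓ 0) := hℓ.comp (contDiff_const.prodMk contDiff_id)
  have hF := (hℓ.contDiff_deriv_fst 0).differentiable (by norm_num)
  have hG : Differentiable ℝ (fun v => fderiv ℝ (ℓ 0) v wh) :=
    ((hf.fderiv_right (m := 1) (by norm_num)).clm_apply contDiff_const).differentiable
      (by norm_num)
  obtain ⟨ν, hν, hmvt⟩ := (hF.sub hG).exists_fderiv_eq_sub βs βh
  have hb := hη₄ ν hν
  set x : Fin m → ℝ := fun i => ν * βs i + (1 - ν) * βh i
  rw [fderiv_sub (hF x) (hG x), ← ContinuousLinearMap.sum_mul_apply_single] at hmvt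
  simp only [_root_.sub_apply, Pi.sub_apply,
    hf.fderiv_fderiv_apply_comm x wh] at hmvt
  have hsegment := Finset.abs_sum_mul_le_sqrt_mul_sqrt Finset.univ (fun j => βs j - βh j)
    (fun j => fderiv ℝ (fun v => deriv (fun t => ℓ t v) 0) x (Pi.single j 1)
      - fderiv ℝ (fun v => fderiv ℝ (ℓ 0) v (Pi.single j 1)) x wh)
  simp only [hmvt, fun j => sub_sq_comm (βs j) (βh j)] at hsegment
  rw [← hη₁] at hsegment
  have hη₁_nonneg : 0 ≤ η₁ := hη₁ ▸ Real.sqrt_nonneg _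
  have hsegment' := hsegment.trans (mul_le_mul_of_nonneg_left hb hη₁_nonneg)
  have hweights : |fderiv ℝ (ℓ 0) βs (wh - ws)| ≤ η₂ * η₃ := by
    rw [← ContinuousLinearMap.sum_mul_apply_single, hη₂, Finset.sum_mul]
    refine (Finset.abs_sum_le_sum_abs _ _).trans (Finset.sum_le_sum fun j _ => ?_)
    rw [abs_mul]
    exact mul_le_mul_of_nonneg_left (hη₃ j) (abs_nonneg _)
  rw [map_sub] at hweights
  simp only [ContinuousLinearMap.sum_mul_apply_single]
  rw [abs_le] at hsegment' hweights ⊢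
  constructor <;> linarith [hsegment'.1, hsegment'.2, hweights.1, hweights.2]
end
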